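/- Let r ≥ 2 be an integer and let G be an equimatchable factor-critical graph having a vertex v such that the vertex-deleted subgraph G − v is isomorphic to the complete graph K_{2r} and the degree of v satisfies 2 ≤ deg(v) ≤ 2r − 2. Then G is not edge-stable equimatchable; that is, there exists an edge e of G such that G − e is not equimatchable. -/

import Mathlib

open SimpleGraph

/-- `M` is a maximal matching of `G` (viewed as a subgraph of `G`): it is a matching and it is
not properly contained in any other matching of `G`. -/
def IsMaximalMatching {V : Type*} (G : SimpleGraph V) (M : G.Subgraph) : Prop :=
  M.IsMatching ∧ ∀ M' : G.Subgraph, M'.IsMatching → M ≤ M' → M' = M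

/-- `G` is equimatchable if all maximal matchings of `G` have the same cardinality. -/
def Equimatchable {V : Type*} (G : SimpleGraph V) : Prop :=
  ∀ M₁ M₂ : G.Subgraph, IsMaximalMatching G M₁ → IsMaximalMatching G M₂ →
    M₁.edgeSet.ncard = M₂.edgeSet.ncard

/-- The matching number ν(G): the maximum cardinality of a matching of `G`. -/
noncomputable def matchNum {V : Type*} (G : SimpleGraph V) : ℕ :=
  sSup {n : ℕ | ∃ M : G.Subgraph, M.IsMatching ∧ M.edgeSet.ncard = n}

/-- `G` is vertex-critical equimatchable (VCE): `G` is equimatchable and deleting any vertex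
yields a non-equimatchable graph. -/
def VCE {V : Type*} (G : SimpleGraph V) : Prop :=
  Equimatchable G ∧ ∀ v : V, ¬ Equimatchable (G.induce {u | u ≠ v})

/-- `G` is edge-critical equimatchable (ECE): `G` is equimatchable and deleting any edge
yields a non-equimatchable graph. -/
def ECE {V : Type*} (G : SimpleGraph V) : Prop :=
  Equimatchable G ∧ ∀ u v : V, G.Adj u v → ¬ Equimatchable (G.deleteEdges {s(u, v)})

/-- `G` is factor-critical: deleting any vertex yields a graph with a perfect matching. -/
def FactorCritical {V : Type*} (G : SimpleGraph V) : Prop :=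
  ∀ v : V, ∃ M : (G.induce {u | u ≠ v}).Subgraph, M.IsPerfectMatching

/-- `G` is 2-connected: at least 3 vertices, connected, and deleting any vertex leaves a
connected graph. -/
def TwoConnected {V : Type*} [Fintype V] (G : SimpleGraph V) : Prop :=
  3 ≤ Fintype.card V ∧ G.Connected ∧ ∀ v : V, (G.induce {u | u ≠ v}).Connected

/-- `G` is bipartite: its vertex set can be partitioned into two parts such that every edge
joins the two parts. -/
def IsBipartiteGraph {V : Type*} (G : SimpleGraph V) : Prop :=
  ∃ s : Set V, ∀ u w : V, G.Adj u w → (u ∈ s ↔ w ∉ s)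

/-- `G` is randomly matchable: every matching of `G` extends to a perfect matching. -/
def RandomlyMatchable {V : Type*} (G : SimpleGraph V) : Prop :=
  ∀ M : G.Subgraph, M.IsMatching → ∃ P : G.Subgraph, M ≤ P ∧ P.IsPerfectMatching

theorem maximal_of_indep {V : Type*} (G : SimpleGraph V) (M : G.Subgraph) (hM : M.IsMatching)
    (h : ∀ x y, x ∉ M.verts → y ∉ M.verts → ¬ G.Adj x y) : IsMaximalMatching G M := by
  refine ⟨hM, fun M' hM' hle => ?_⟩
  have key : ∀ x y, x ∈ M.verts → M'.Adj x y → M.Adj x y := by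
    intro x y hx hxy
    obtain ⟨z, hz, -⟩ := hM hx
    have := (hM' (M'.edge_vert hxy)).unique hxy (hle.2 hz)
    exact this ▸ hz
  have adj : ∀ x y, M'.Adj x y → M.Adj x y := by
    intro x y hxy
    by_cases hx : x ∈ M.verts
    · exact key x y hx hxy
    by_cases hy : y ∈ M.verts
    · exact (key y x hy hxy.symm).symm
    · exact absurd hxy.adj_sub (h x y hx hy)
  refine le_antisymm (show M'.verts ⊆ M.verts ∧ ∀ ⦃x y⦄, M'.Adj x y → M.Adj x y from
    ⟨fun x hx => ?_, fun x y hxy => adj x y hxy⟩) hle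
  obtain ⟨z, hz, -⟩ := hM' hx
  exact M.edge_vert (adj x z hz)

/-- Let `r ≥ 2` and let `G` be an equimatchable factor-critical graph with a vertex `v` such
that `G − v ≅ K_{2r}` and `2 ≤ deg(v) ≤ 2r − 2`. Then `G` is not edge-stable equimatchable:
some edge deletion destroys equimatchability. -/
theorem classA_not_ese {V : Type*} [Fintype V] (r : ℕ) (hr : 2 ≤ r)
    (G : SimpleGraph V) (heq : Equimatchable G) (hfc : FactorCritical G) (v : V)
    (hiso : Nonempty ((G.induce {u | u ≠ v}) ≃g (⊤ : SimpleGraph (Fin (2 * r)))))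
    (hdeg₁ : 2 ≤ (G.neighborSet v).ncard) (hdeg₂ : (G.neighborSet v).ncard ≤ 2 * r - 2) :
    ∃ x y : V, G.Adj x y ∧ ¬ Equimatchable (G.deleteEdges {s(x, y)}) := by
  obtain ⟨f⟩ := hiso
  classical
  have hcl : ∀ x y, x ≠ v → y ≠ v → x ≠ y → G.Adj x y := by
    intro x y hx hy hxy
    have h1 : (G.induce {u | u ≠ v}).Adj ⟨x, hx⟩ ⟨y, hy⟩ := by
      rw [← f.map_adj_iff, top_adj]
      intro h
      exact hxy (congrArg Subtype.val (f.injective h))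
    exact h1
  have hcard : ({u | u ≠ v} : Set V).ncard = 2 * r := by
    rw [← Nat.card_coe_set_eq, Nat.card_congr f.toEquiv]
    simp
  have hsub : G.neighborSet v ⊆ {u | u ≠ v} := fun x hx => (G.ne_of_adj hx).symm
  have hdiff := Set.ncard_sdiff_add_ncard_of_subset hsub
  obtain ⟨a, b, ha, hb, hab⟩ := (Set.one_lt_ncard_iff
    (s := {u | u ≠ v} \ G.neighborSet v)).1 (by omega)
  obtain ⟨hav, hva⟩ := ha
  obtain ⟨hbv, hvb⟩ := hb
  simp only [Set.mem_ofPred_eq, mem_neighborSet] at hav hva hbv hvb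
  have h2 : ({a, b} : Set V) ⊆ {u | u ≠ v} := by
    rintro x (rfl | rfl) <;> assumption
  have hdiff2 := Set.ncard_sdiff_add_ncard_of_subset h2
  rw [Set.ncard_pair hab] at hdiff2
  obtain ⟨c, d, hc, hd, hcd⟩ := (Set.one_lt_ncard_iff
    (s := {u | u ≠ v} \ ({a, b} : Set V))).1 (by omega)
  simp only [Set.mem_sdiff, Set.mem_ofPred_eq, Set.mem_insert_iff, Set.mem_singleton_iff,
    not_or] at hc hd
  obtain ⟨hcv, hca, hcb⟩ := hc
  obtain ⟨hdv, hda, hdb⟩ := hd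
  refine ⟨a, b, hcl a b hav hbv hab, fun heq' => ?_⟩
  generalize hH : G.deleteEdges {s(a, b)} = H at heq'
  have hHadj : ∀ x y, H.Adj x y ↔ G.Adj x y ∧ s(x, y) ≠ s(a, b) := by
    intro x y; simp [← hH]
  have h4 : ({c, d} : Set V) ⊆ {u | u ≠ v} \ {a, b} := by
    rintro x (rfl | rfl) <;> simp [*]
  have hdiff4 := Set.ncard_sdiff_add_ncard_of_subset h4
  rw [Set.ncard_pair hcd] at hdiff4
  generalize hW : ({u | u ≠ v} \ {a, b}) \ ({c, d} : Set V) = W at hdiff4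
  have hWmem : ∀ x, x ∈ W ↔ x ≠ v ∧ x ≠ a ∧ x ≠ b ∧ x ≠ c ∧ x ≠ d := by
    intro x; simp [← hW]; clear * -; tauto
  have hWcl : H.IsClique W := by
    intro x hx y hy hxy
    rw [hWmem] at hx hy
    rw [hHadj]
    refine ⟨hcl x y hx.1 hy.1 hxy, ?_⟩
    simp [hx, hy]
  have hEven : Even W.ncard := ⟨r - 2, by omega⟩
  obtain ⟨N, hNv, hN⟩ := (hWcl.even_iff_exists_isMatching W.toFinite).1 hEven
  have acd : H.Adj c d := (hHadj _ _).2 ⟨hcl c d hcv hdv hcd, by simp [hca, hcb]⟩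
  have aac : H.Adj a c := (hHadj _ _).2 ⟨hcl a c hav hcv (Ne.symm hca), by simp [hca, hcb, hab]⟩
  have abd : H.Adj b d := (hHadj _ _).2 ⟨hcl b d hbv hdv (Ne.symm hdb), by simp [hda, hdb, hab]⟩
  have m1 : (N ⊔ H.subgraphOfAdj acd).IsMatching := by
    refine hN.sup (Subgraph.IsMatching.subgraphOfAdj acd) ?_
    rw [hN.support_eq_verts, (Subgraph.IsMatching.subgraphOfAdj acd).support_eq_verts, hNv,
      Set.disjoint_left]
    intro x hx
    rw [hWmem] at hx
    simp [hx]
  have m2' : (H.subgraphOfAdj aac ⊔ H.subgraphOfAdj abd).IsMatching := by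
    refine (Subgraph.IsMatching.subgraphOfAdj aac).sup (Subgraph.IsMatching.subgraphOfAdj abd) ?_
    rw [(Subgraph.IsMatching.subgraphOfAdj aac).support_eq_verts,
      (Subgraph.IsMatching.subgraphOfAdj abd).support_eq_verts, Set.disjoint_left]
    rintro x (rfl | rfl)
    · simp [hab, Ne.symm hda]
    · simp [hcb, hcd]
  have m2 : (N ⊔ (H.subgraphOfAdj aac ⊔ H.subgraphOfAdj abd)).IsMatching := by
    refine hN.sup m2' ?_
    rw [hN.support_eq_verts, m2'.support_eq_verts, hNv, Set.disjoint_left]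
    intro x hx
    rw [hWmem] at hx
    simp [hx]
  have v1 : ∀ x, x ∉ (N ⊔ H.subgraphOfAdj acd).verts → x = v ∨ x = a ∨ x = b := by
    intro x hx
    simp only [Subgraph.verts_sup, hNv, subgraphOfAdj_verts, Set.mem_union, hWmem,
      Set.mem_insert_iff, Set.mem_singleton_iff] at hx
    clear * - hx
    tauto
  have v2 : ∀ x, x ∉ (N ⊔ (H.subgraphOfAdj aac ⊔ H.subgraphOfAdj abd)).verts → x = v := by
    intro x hx
    simp only [Subgraph.verts_sup, hNv, subgraphOfAdj_verts, Set.mem_union, hWmem,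
      Set.mem_insert_iff, Set.mem_singleton_iff] at hx
    clear * - hx
    tauto
  have x1 := maximal_of_indep H _ m1 (by
    intro x y hx hy hxy
    rw [hHadj] at hxy
    obtain ⟨h, h'⟩ := hxy
    have hs := h.symm
    rcases v1 x hx with h1 | h1 | h1 <;> rcases v1 y hy with h2 | h2 | h2 <;>
      rw [h1, h2] at h hs h'
    · exact h.ne rfl
    · exact hva h
    · exact hvb h
    · exact hva hs
    · exact h.ne rfl
    · exact h' rfl
    · exact hvb hs
    · exact h' Sym2.eq_swap
    · exact h.ne rfl)
  have x2 := maximal_of_indep H _ m2 (by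
    intro x y hx hy hxy
    exact hxy.ne ((v2 x hx).trans (v2 y hy).symm))
  have e := heq' _ _ x1 x2
  simp only [Subgraph.edgeSet_sup, edgeSet_subgraphOfAdj] at e
  have le1 := Set.ncard_union_le N.edgeSet {s(c, d)}
  rw [Set.ncard_singleton] at le1
  have hnotin : ∀ x y, x ∉ W → s(x, y) ∉ N.edgeSet := by
    intro x y hx h
    rw [Subgraph.mem_edgeSet] at h
    exact hx (hNv ▸ N.edge_vert h)
  have e1 : s(a, c) ∉ N.edgeSet := hnotin a c (by simp [hWmem])
  have e2 : s(b, d) ∉ N.edgeSet := hnotin b d (by simp [hWmem])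
  have hne : s(a, c) ≠ s(b, d) := by simp [hab, Ne.symm hda]
  have eq2 : (N.edgeSet ∪ ({s(a, c)} ∪ {s(b, d)})).ncard = N.edgeSet.ncard + 2 := by
    rw [Set.ncard_union_eq (by simp [e1, e2]) (Set.toFinite _) (Set.toFinite _),
      Set.singleton_union, Set.ncard_pair hne]
  rw [e, eq2] at le1
  exact absurd le1 (by simp)
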